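/- arXiv:1802.08498 — 5 statements merged into one kernel-verified Lean document; each statement's English description precedes it below -/
import Mathlib

section
/- For every 𝐢 ∈ ℤ_{≥0}^n and every integer N ≥ ‖𝐢‖, the degree-(N−‖𝐢‖) homogeneous part of the ideal I^𝐢 recovers I^𝐢_N exactly; that is, I^𝐢 ∩ ℂ[x]_{N−‖𝐢‖} = I^𝐢_N. -/
open MvPolynomial

noncomputable section

/-- The degree-`d` homogeneous part `ℂ[x]_d` of `ℂ[x_0,…,x_M]`. -/
def homogPart (M d : ℕ) : Submodule ℂ (MvPolynomial (Fin (M + 1)) ℂ) :=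
  homogeneousSubmodule (Fin (M + 1)) ℂ d

/-- `‖𝐢‖ = i_1 + ⋯ + i_n`. -/
def normI {n : ℕ} (i : Fin n → ℕ) : ℕ := ∑ j, i j

/-- `r^𝐢 = r_1^{i_1} ⋯ r_n^{i_n}`. -/
def rPow {M n : ℕ} (r : Fin n → MvPolynomial (Fin (M + 1)) ℂ) (i : Fin n → ℕ) :
    MvPolynomial (Fin (M + 1)) ℂ := ∏ j, (r j) ^ (i j)

/-- The space `I^𝐢_N`: all `p ∈ ℂ[x]_{N-‖𝐢‖}` such that
`r^𝐢·p - Σ_{𝐞 >_lex 𝐢, ‖𝐞‖ ≤ N} r^𝐞·c 𝐞 ∈ I_N = I ∩ ℂ[x]_N` for suitable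
`c 𝐞 ∈ ℂ[x]_{N-‖𝐞‖}`. -/
def IfilSet (M n : ℕ) (I : Ideal (MvPolynomial (Fin (M + 1)) ℂ))
    (r : Fin n → MvPolynomial (Fin (M + 1)) ℂ) (i : Fin n → ℕ) (N : ℕ) :
    Set (MvPolynomial (Fin (M + 1)) ℂ) :=
  {p | p ∈ homogPart M (N - normI i) ∧
    ∃ (s : Finset (Fin n → ℕ)) (c : (Fin n → ℕ) → MvPolynomial (Fin (M + 1)) ℂ),
      (∀ e ∈ s, toLex i < toLex e ∧ normI e ≤ N ∧ c e ∈ homogPart M (N - normI e)) ∧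
      (rPow r i * p - ∑ e ∈ s, rPow r e * c e ∈ I ∧
        rPow r i * p - ∑ e ∈ s, rPow r e * c e ∈ homogPart M N)}

/-- The ideal `I^𝐢` generated by `⋃_{N ≥ ‖𝐢‖} I^𝐢_N`. -/
def Iideal (M n : ℕ) (I : Ideal (MvPolynomial (Fin (M + 1)) ℂ))
    (r : Fin n → MvPolynomial (Fin (M + 1)) ℂ) (i : Fin n → ℕ) :
    Ideal (MvPolynomial (Fin (M + 1)) ℂ) :=
  Ideal.span {p | ∃ N, normI i ≤ N ∧ p ∈ IfilSet M n I r i N}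

/-- `Δ^𝐢_N = dim_ℂ (ℂ[x]_{N-‖𝐢‖} / I^𝐢_N)`. -/
def Delta (M n : ℕ) (I : Ideal (MvPolynomial (Fin (M + 1)) ℂ))
    (r : Fin n → MvPolynomial (Fin (M + 1)) ℂ) (i : Fin n → ℕ) (N : ℕ) : ℕ :=
  Module.finrank ℂ
    (↥(homogPart M (N - normI i)) ⧸
      (Submodule.span ℂ (IfilSet M n I r i N)).comap (homogPart M (N - normI i)).subtype)

/-- `dim_ℂ (ℂ[x]_N / I_N)`, the Hilbert function of `I`. -/
def DeltaV (M : ℕ) (I : Ideal (MvPolynomial (Fin (M + 1)) ℂ)) (N : ℕ) : ℕ :=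
  Module.finrank ℂ
    (↥(homogPart M N) ⧸ (I.restrictScalars ℂ).comap (homogPart M N).subtype)

/-- `τ_N = {𝐢 ∈ ℤ_{≥0}^n : ‖𝐢‖ ≤ N}` as a `Finset`. -/
def tauN (n N : ℕ) : Finset (Fin n → ℕ) :=
  (Fintype.piFinset fun _ : Fin n => Finset.range (N + 1)).filter fun i => normI i ≤ N

/-- The ideal `I` is homogeneous: it contains every homogeneous component of its members. -/
def IsHomogeneousIdeal {M : ℕ} (I : Ideal (MvPolynomial (Fin (M + 1)) ℂ)) : Prop :=
  ∀ p ∈ I, ∀ d : ℕ, homogeneousComponent d p ∈ I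

end

/-- Multiplication by a homogeneous polynomial of degree `k` shifts homogeneous components
by `k`. -/
theorem homogeneousComponent_mul_of_isHomogeneous {σ R : Type*} [CommSemiring R]
    {a : MvPolynomial σ R} {k : ℕ} (ha : a.IsHomogeneous k) (b : MvPolynomial σ R) (d : ℕ) :
    homogeneousComponent d (a * b) =
      if k ≤ d then a * homogeneousComponent (d - k) b else 0 := by
  let := MvPolynomial.gradedAlgebra (σ := σ) (R := R)
  have h := DirectSum.coe_decompose_mul_of_left_mem (homogeneousSubmodule σ R) (b := b) d
    ((mem_homogeneousSubmodule k a).2 ha)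
  simp only [← decomposition.decompose'_apply]
  exact h

theorem isHomogeneous_rPow {M n : ℕ} {r : Fin n → MvPolynomial (Fin (M + 1)) ℂ}
    (hr : ∀ j, r j ∈ homogPart M 1) (e : Fin n → ℕ) : (rPow r e).IsHomogeneous (normI e) := by
  refine IsHomogeneous.prod _ _ _ fun j _ => ?_
  simpa using ((mem_homogeneousSubmodule 1 (r j)).1 (hr j)).pow (e j)

/-- The ideal generated by `I` and all `r^𝐞` with `𝐞 >_lex 𝐢`. -/
noncomputable def lexTailIdeal {M n : ℕ} (I : Ideal (MvPolynomial (Fin (M + 1)) ℂ))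
    (r : Fin n → MvPolynomial (Fin (M + 1)) ℂ) (i : Fin n → ℕ) :
    Ideal (MvPolynomial (Fin (M + 1)) ℂ) :=
  I ⊔ Ideal.span (rPow r '' {e | toLex i < toLex e})

theorem rPow_mul_mem_lexTailIdeal_of_mem_IfilSet {M n : ℕ}
    {I : Ideal (MvPolynomial (Fin (M + 1)) ℂ)} {r : Fin n → MvPolynomial (Fin (M + 1)) ℂ}
    {i : Fin n → ℕ} {N : ℕ} {p : MvPolynomial (Fin (M + 1)) ℂ} (hp : p ∈ IfilSet M n I r i N) :
    rPow r i * p ∈ lexTailIdeal I r i := by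
  obtain ⟨-, s, c, hs, hI, -⟩ := hp
  rw [← sub_add_cancel (rPow r i * p) (∑ e ∈ s, rPow r e * c e)]
  refine add_mem (Ideal.mem_sup_left hI) (Ideal.mem_sup_right (sum_mem fun e he => ?_))
  exact Ideal.mul_mem_right _ _ (Ideal.subset_span ⟨e, (hs e he).1, rfl⟩)

theorem mem_IfilSet_of_rPow_mul_mem_lexTailIdeal {M n : ℕ}
    {I : Ideal (MvPolynomial (Fin (M + 1)) ℂ)} (hI : IsHomogeneousIdeal I)
    {r : Fin n → MvPolynomial (Fin (M + 1)) ℂ} (hr : ∀ j, r j ∈ homogPart M 1)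
    {i : Fin n → ℕ} {N : ℕ} (hN : normI i ≤ N) {p : MvPolynomial (Fin (M + 1)) ℂ}
    (hp : p ∈ homogPart M (N - normI i)) (hmem : rPow r i * p ∈ lexTailIdeal I r i) :
    p ∈ IfilSet M n I r i N := by
  obtain ⟨a, ha, b, hb, hab⟩ := Submodule.mem_sup.1 hmem
  obtain ⟨c, hc, rfl⟩ := (Finsupp.mem_span_image_iff_linearCombination _).1 hb
  have hdeg : homogeneousComponent N (rPow r i * p) = rPow r i * p := by
    rw [homogeneousComponent_mul_of_isHomogeneous (isHomogeneous_rPow hr i), if_pos hN,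
      homogeneousComponent_eq_self hp]
  have key : rPow r i * p - ∑ e ∈ c.support with normI e ≤ N,
      rPow r e * homogeneousComponent (N - normI e) (c e) = homogeneousComponent N a := by
    rw [← hdeg, ← hab, map_add, Finsupp.linearCombination_apply, Finsupp.sum, map_sum,
      Finset.sum_filter, sub_eq_iff_eq_add]
    congr 1
    refine Finset.sum_congr rfl fun e _ => ?_
    rw [smul_eq_mul, mul_comm,
      homogeneousComponent_mul_of_isHomogeneous (isHomogeneous_rPow hr e)]
  refine ⟨hp, c.support.filter (normI · ≤ N), fun e => homogeneousComponent (N - normI e) (c e),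
    fun e he => ?_, ?_⟩
  · rw [Finset.mem_filter] at he
    exact ⟨hc he.1, he.2, homogeneousComponent_mem _ _⟩
  · rw [key]
    exact ⟨hI a ha N, homogeneousComponent_mem _ _⟩

/-- For every `𝐢 ∈ ℤ_{≥0}^n` and every `N ≥ ‖𝐢‖`, one has `I^𝐢 ∩ ℂ[x]_{N-‖𝐢‖} = I^𝐢_N`. -/
theorem Iideal_inter_homogPart (M n : ℕ) (hM : 1 ≤ M) (hn : 1 ≤ n)
    (I : Ideal (MvPolynomial (Fin (M + 1)) ℂ)) (hI : IsHomogeneousIdeal I)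
    (r : Fin n → MvPolynomial (Fin (M + 1)) ℂ)
    (hr : ∀ j, r j ≠ 0 ∧ r j ∈ homogPart M 1)
    (i : Fin n → ℕ) (N : ℕ) (hN : normI i ≤ N) :
    ((Iideal M n I r i : Ideal (MvPolynomial (Fin (M + 1)) ℂ)) :
        Set (MvPolynomial (Fin (M + 1)) ℂ)) ∩ (homogPart M (N - normI i) : Set _)
      = IfilSet M n I r i N := by
  refine Set.Subset.antisymm (fun p ⟨hp, hdeg⟩ => ?_)
    fun p hp => ⟨Ideal.subset_span ⟨N, hN, hp⟩, hp.1⟩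
  refine mem_IfilSet_of_rPow_mul_mem_lexTailIdeal hI (fun j => (hr j).2) hN hdeg ?_
  have hle : Iideal M n I r i ≤
      Submodule.comap (LinearMap.mulLeft (MvPolynomial (Fin (M + 1)) ℂ) (rPow r i))
        (lexTailIdeal I r i) :=
    Ideal.span_le.2 fun q ⟨_, _, hq⟩ => rPow_mul_mem_lexTailIdeal_of_mem_IfilSet hq
  exact hle hp
end

section
/- Let 𝐢_1, 𝐢_2 ∈ ℤ_{≥0}^n satisfy 𝐢_1 − 𝐢_2 ∈ ℤ_{≥0}^n (i.e., 𝐢_2 ≤ 𝐢_1 componentwise). Then for every integer N ≥ ‖𝐢_2‖ one has I^{𝐢_2}_N ⊆ I^{𝐢_1}_{N+‖𝐢_1‖−‖𝐢_2‖}, and consequently the ideal I^{𝐢_2} is contained in the ideal I^{𝐢_1}. -/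
open MvPolynomial

theorem normI_add {n : ℕ} (i j : Fin n → ℕ) : normI (i + j) = normI i + normI j := by
  simp [normI, Finset.sum_add_distrib]

theorem rPow_add {M n : ℕ} (r : Fin n → MvPolynomial (Fin (M + 1)) ℂ) (i j : Fin n → ℕ) :
    rPow r (i + j) = rPow r i * rPow r j := by
  simp [rPow, pow_add, Finset.prod_mul_distrib]

theorem rPow_mem_homogPart {M n : ℕ} {r : Fin n → MvPolynomial (Fin (M + 1)) ℂ}
    (hr : ∀ j, r j ∈ homogPart M 1) (i : Fin n → ℕ) : rPow r i ∈ homogPart M (normI i) := by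
  refine IsHomogeneous.prod _ _ _ fun j _ => ?_
  simpa using IsHomogeneous.pow (hr j) (i j)

theorem toLex_add_lt_toLex_add {n : ℕ} {i e : Fin n → ℕ} (h : toLex i < toLex e)
    (d : Fin n → ℕ) : toLex (i + d) < toLex (e + d) := by
  obtain ⟨k, hk, hlt⟩ := h
  exact ⟨k, fun j hj => congrArg (· + d j) (hk j hj), Nat.add_lt_add_right hlt (d k)⟩

theorem IfilSet_subset_IfilSet_add {M n : ℕ} (I : Ideal (MvPolynomial (Fin (M + 1)) ℂ))
    {r : Fin n → MvPolynomial (Fin (M + 1)) ℂ} (hr : ∀ j, r j ∈ homogPart M 1)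
    (i d : Fin n → ℕ) (N : ℕ) :
    IfilSet M n I r i N ⊆ IfilSet M n I r (i + d) (N + normI d) := by
  rintro p ⟨hp, s, c, hs, hI, hN⟩
  have key : rPow r (i + d) * p -
      ∑ e ∈ s.map (addRightEmbedding d), rPow r e * c (e - d) =
      rPow r d * (rPow r i * p - ∑ e ∈ s, rPow r e * c e) := by
    simp only [Finset.sum_map, addRightEmbedding_apply, add_tsub_cancel_right, rPow_add, mul_sub,
      Finset.mul_sum]
    congr 1
    · ring
    · exact Finset.sum_congr rfl fun e _ => by ring
  refine ⟨?_, s.map (addRightEmbedding d), fun e => c (e - d), ?_, ?_, ?_⟩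
  · rwa [normI_add, Nat.add_sub_add_right]
  · intro _ he'
    obtain ⟨e, he, rfl⟩ := Finset.mem_map.1 he'
    obtain ⟨hlt, hle, hc⟩ := hs e he
    refine ⟨toLex_add_lt_toLex_add hlt d, ?_, ?_⟩
    · simpa [normI_add] using hle
    · simpa [normI_add, Nat.add_sub_add_right] using hc
  · rw [key]
    exact I.mul_mem_left _ hI
  · rw [key, add_comm N]
    exact IsHomogeneous.mul (rPow_mem_homogPart hr d) hN

/-- If `𝐢_2 ≤ 𝐢_1` componentwise then `I^{𝐢_2}_N ⊆ I^{𝐢_1}_{N+‖𝐢_1‖-‖𝐢_2‖}` for every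
`N ≥ ‖𝐢_2‖`, and consequently `I^{𝐢_2} ⊆ I^{𝐢_1}`. -/
theorem IfilSet_mono (M n : ℕ) (hM : 1 ≤ M) (hn : 1 ≤ n)
    (I : Ideal (MvPolynomial (Fin (M + 1)) ℂ)) (hI : IsHomogeneousIdeal I)
    (r : Fin n → MvPolynomial (Fin (M + 1)) ℂ)
    (hr : ∀ j, r j ≠ 0 ∧ r j ∈ homogPart M 1)
    (i₁ i₂ : Fin n → ℕ) (h12 : ∀ j, i₂ j ≤ i₁ j) :
    (∀ N : ℕ, normI i₂ ≤ N →
      IfilSet M n I r i₂ N ⊆ IfilSet M n I r i₁ (N + normI i₁ - normI i₂)) ∧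
    Iideal M n I r i₂ ≤ Iideal M n I r i₁ := by
  have hr' : ∀ j, r j ∈ homogPart M 1 := fun j => (hr j).2
  obtain ⟨d, rfl⟩ : ∃ d, i₁ = i₂ + d := exists_add_of_le h12
  have h (N : ℕ) : IfilSet M n I r i₂ N ⊆
      IfilSet M n I r (i₂ + d) (N + normI (i₂ + d) - normI i₂) := by
    have hN : N + normI (i₂ + d) - normI i₂ = N + normI d := by
      rw [normI_add]
      omega
    rw [hN]
    exact IfilSet_subset_IfilSet_add I hr' i₂ d N
  refine ⟨fun N _ => h N, Ideal.span_mono ?_⟩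
  rintro p ⟨N, hN, hp⟩
  exact ⟨_, by omega, h N hp⟩
end

section
/- The set of ideals {I^𝐢 : 𝐢 ∈ ℤ_{≥0}^n} is a finite set. -/
open MvPolynomial

/-- Multiplying by `r^𝐤` sends a witness for `I^𝐢_N` to a witness for `I^{𝐢+𝐤}_{N+‖𝐤‖}`. -/
theorem IfilSet_subset_add (M n : ℕ) (I : Ideal (MvPolynomial (Fin (M + 1)) ℂ))
    (r : Fin n → MvPolynomial (Fin (M + 1)) ℂ) (hr : ∀ j, r j ∈ homogPart M 1)
    (i k : Fin n → ℕ) (N : ℕ) :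
    IfilSet M n I r i N ⊆ IfilSet M n I r (i + k) (N + normI k) := by
  have norm_add (e : Fin n → ℕ) : normI (e + k) = normI e + normI k := by
    simp [normI, Finset.sum_add_distrib]
  have pow_add (e : Fin n → ℕ) : rPow r (e + k) = rPow r k * rPow r e := by
    simp [rPow, _root_.pow_add, Finset.prod_mul_distrib, mul_comm]
  have pow_homog : (rPow r k).IsHomogeneous (normI k) := by
    refine IsHomogeneous.prod _ _ _ fun j _ ↦ ?_
    simpa using IsHomogeneous.pow ((mem_homogeneousSubmodule _ _).1 (hr j)) (k j)
  rintro p ⟨hp, s, c, hs, hI, hN⟩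
  refine ⟨by rwa [norm_add, Nat.add_sub_add_right], s.map (addRightEmbedding k),
    fun e ↦ c (e - k), ?_, ?_⟩
  · intro e he
    obtain ⟨e, hes, rfl⟩ := Finset.mem_map.1 he
    obtain ⟨hlt, hle, hc⟩ := hs e hes
    simp only [addRightEmbedding_apply, add_tsub_cancel_right, norm_add, toLex_add]
    exact ⟨add_lt_add_left hlt _, by gcongr, by rwa [Nat.add_sub_add_right]⟩
  · have key : rPow r (i + k) * p
        - ∑ e ∈ s.map (addRightEmbedding k), rPow r e * c (e - k)
        = rPow r k * (rPow r i * p - ∑ e ∈ s, rPow r e * c e) := by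
      simp [Finset.sum_map, pow_add, mul_sub, Finset.mul_sum, mul_assoc]
    rw [key]
    refine ⟨I.mul_mem_left _ hI, (mem_homogeneousSubmodule _ _).2 ?_⟩
    rw [add_comm N]
    exact pow_homog.mul ((mem_homogeneousSubmodule _ _).1 hN)

theorem Iideal_monotone (M n : ℕ) (I : Ideal (MvPolynomial (Fin (M + 1)) ℂ))
    (r : Fin n → MvPolynomial (Fin (M + 1)) ℂ) (hr : ∀ j, r j ∈ homogPart M 1) :
    Monotone (Iideal M n I r) := by
  intro i j hij
  obtain ⟨k, rfl⟩ := exists_add_of_le hij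
  refine Ideal.span_mono ?_
  rintro p ⟨N, hN, hp⟩
  refine ⟨N + normI k, ?_, IfilSet_subset_add M n I r hr i k N hp⟩
  simpa [normI, Finset.sum_add_distrib] using hN

/-- A monotone map from a well-quasi-order to a partial order with the ascending chain condition
has finite range. -/
theorem Monotone.finite_range_of_wellQuasiOrderedLE {α β : Type*} [Preorder α]
    [WellQuasiOrderedLE α] [PartialOrder β] [WellFoundedGT β] {f : α → β} (hf : Monotone f) :
    (Set.range f).Finite := by
  by_contra hinf
  let u := Set.Infinite.natEmbedding _ hinf
  choose a ha using fun m ↦ (u m).2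
  obtain ⟨g, hg⟩ := (wellQuasiOrdered_iff_exists_monotone_subseq.1
    (wellQuasiOrdered_le (α := α))) a
  let v : ℕ →o β := ⟨fun m ↦ f (a (g m)), fun m l h ↦ hf (hg m l h)⟩
  obtain ⟨m, hm⟩ := WellFoundedGT.monotone_chain_condition v
  have h : f (a (g m)) = f (a (g (m + 1))) := hm (m + 1) m.le_succ
  rw [ha, ha] at h
  exact m.succ_ne_self (g.injective (u.injective (Subtype.ext h))).symm

/-- The set of ideals `{I^𝐢 : 𝐢 ∈ ℤ_{≥0}^n}` is finite. -/
theorem Iideal_range_finite (M n : ℕ) (hM : 1 ≤ M) (hn : 1 ≤ n)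
    (I : Ideal (MvPolynomial (Fin (M + 1)) ℂ)) (hI : IsHomogeneousIdeal I)
    (r : Fin n → MvPolynomial (Fin (M + 1)) ℂ)
    (hr : ∀ j, r j ≠ 0 ∧ r j ∈ homogPart M 1) :
    (Set.range fun i : Fin n → ℕ => Iideal M n I r i).Finite :=
  (Iideal_monotone M n I r fun j ↦ (hr j).2).finite_range_of_wellQuasiOrderedLE
end

section
/- For every integer N ≥ 0, one has Σ_{𝐢 ∈ τ_N} Δ^𝐢_N = dim_ℂ(ℂ[x]_N / I_N); that is, the sum over all 𝐢 ∈ ℤ_{≥0}^n with ‖𝐢‖ ≤ N of dim_ℂ(ℂ[x]_{N−‖𝐢‖}/I^𝐢_N) equals the dimension of the degree-N graded piece of ℂ[x_0,…,x_M]/I. -/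
open MvPolynomial

/-- `A / g⁻¹(F)` has dimension `dim (g(A) + F) - dim F`. -/
theorem finrank_quotient_comap_add_finrank {𝕜 E Q : Type*} [Field 𝕜] [AddCommGroup E] [Module 𝕜 E]
    [AddCommGroup Q] [Module 𝕜 Q] (A : Submodule 𝕜 E) [FiniteDimensional 𝕜 A]
    (g : E →ₗ[𝕜] Q) (F : Submodule 𝕜 Q) [FiniteDimensional 𝕜 F] :
    Module.finrank 𝕜 (A ⧸ (F.comap g).comap A.subtype) + Module.finrank 𝕜 F =
      Module.finrank 𝕜 ↥(A.map g ⊔ F) := by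
  have hker : LinearMap.ker (F.mkQ ∘ₗ g ∘ₗ A.subtype) = (F.comap g).comap A.subtype := by
    ext; simp
  have hrange : LinearMap.range (F.mkQ ∘ₗ g ∘ₗ A.subtype) =
      LinearMap.range (F.mkQ.domRestrict (A.map g ⊔ F)) := by
    rw [LinearMap.range_domRestrict, Submodule.map_sup, Submodule.mkQ_map_self, sup_bot_eq,
      LinearMap.range_comp, LinearMap.range_comp, Submodule.range_subtype]
  have hker' : LinearMap.ker (F.mkQ.domRestrict (A.map g ⊔ F)) =
      F.comap (A.map g ⊔ F).subtype := by
    ext; simp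
  rw [← LinearMap.finrank_range_add_finrank_ker (F.mkQ.domRestrict (A.map g ⊔ F)), ← hker,
    (LinearMap.quotKerEquivRange _).finrank_eq, hrange, hker',
    (Submodule.comapSubtypeEquivOfLe (le_sup_right : F ≤ A.map g ⊔ F)).finrank_eq]

/-- The dimensions of the graded pieces of the filtration `F_i = ∑_{e > i} f_e(A_e)` add up to
the dimension of `∑_e f_e(A_e)`. -/
theorem sum_finrank_quotient_comap_iSup {𝕜 ι E Q : Type*} [Field 𝕜] [AddCommGroup E] [Module 𝕜 E]
    [AddCommGroup Q] [Module 𝕜 Q] [LinearOrder ι] (A : ι → Submodule 𝕜 E)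
    [∀ i, FiniteDimensional 𝕜 (A i)] (f : ι → E →ₗ[𝕜] Q) (T : Finset ι) :
    ∑ i ∈ T, Module.finrank 𝕜
        (A i ⧸ ((⨆ e ∈ T.filter (i < ·), (A e).map (f e)).comap (f i)).comap (A i).subtype) =
      Module.finrank 𝕜 ↥(⨆ e ∈ T, (A e).map (f e)) := by
  induction T using Finset.induction_on_min with
  | empty => rw [← Finset.sup_eq_iSup, Finset.sup_empty, finrank_bot, Finset.sum_empty]
  | insert a T ha ih =>
    have : FiniteDimensional 𝕜 ↥(⨆ e ∈ T, (A e).map (f e)) := by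
      rw [← Finset.sup_eq_iSup]
      infer_instance
    have hfilter : (insert a T).filter (a < ·) = T := by
      ext e
      simp only [Finset.mem_filter, Finset.mem_insert]
      exact ⟨fun ⟨h, hlt⟩ => h.resolve_left hlt.ne', fun h => ⟨Or.inr h, ha e h⟩⟩
    have hfilter' : ∀ i ∈ T, (insert a T).filter (i < ·) = T.filter (i < ·) := fun i hi => by
      rw [Finset.filter_insert, if_neg (ha i hi).not_gt]
    rw [Finset.sum_insert fun h => (ha a h).false, hfilter, Finset.iSup_insert,
      ← finrank_quotient_comap_add_finrank, ← ih]
    congr 1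
    exact Finset.sum_congr rfl fun i hi => by rw [hfilter' i hi]

instance finiteDimensional_homogPart (M d : ℕ) : FiniteDimensional ℂ (homogPart M d) := by
  have hle : homogPart M d ≤ restrictTotalDegree (Fin (M + 1)) ℂ d := fun p hp => by
    rw [mem_restrictTotalDegree]
    exact IsHomogeneous.totalDegree_le hp
  exact Submodule.finiteDimensional_of_le hle

theorem rPow_mul_mem_homogPart {M n N : ℕ} {r : Fin n → MvPolynomial (Fin (M + 1)) ℂ}
    (hr : ∀ j, r j ∈ homogPart M 1) {i : Fin n → ℕ} (hi : normI i ≤ N)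
    {p : MvPolynomial (Fin (M + 1)) ℂ} (hp : p ∈ homogPart M (N - normI i)) :
    rPow r i * p ∈ homogPart M N := by
  have hpow : (rPow r i).IsHomogeneous (normI i) :=
    IsHomogeneous.prod _ _ _ fun j _ => by simpa using IsHomogeneous.pow (hr j) (i j)
  have := hpow.mul hp
  rwa [Nat.add_sub_cancel' hi] at this

theorem mem_tauN {n N : ℕ} {i : Fin n → ℕ} : i ∈ tauN n N ↔ normI i ≤ N := by
  simp only [tauN, Finset.mem_filter, Fintype.mem_piFinset, Finset.mem_range, Nat.lt_succ_iff,
    and_iff_right_iff_imp]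
  exact fun h j => (Finset.single_le_sum (fun _ _ => Nat.zero_le _) (Finset.mem_univ j)).trans h

/-- Multiplication by `r^𝐢` followed by reduction modulo `I`. -/
noncomputable def rPowMulMod {M n : ℕ} (I : Ideal (MvPolynomial (Fin (M + 1)) ℂ))
    (r : Fin n → MvPolynomial (Fin (M + 1)) ℂ) (i : Fin n → ℕ) :
    MvPolynomial (Fin (M + 1)) ℂ →ₗ[ℂ] MvPolynomial (Fin (M + 1)) ℂ ⧸ I.restrictScalars ℂ :=
  (I.restrictScalars ℂ).mkQ ∘ₗ LinearMap.mulLeft ℂ (rPow r i)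

noncomputable instance decidableLTLexPi (n : ℕ) : DecidableLT (Lex (Fin n → ℕ)) :=
  fun i e => LinearOrder.toDecidableLT i e

theorem mem_IfilSet_iff {M n N : ℕ} {I : Ideal (MvPolynomial (Fin (M + 1)) ℂ)}
    {r : Fin n → MvPolynomial (Fin (M + 1)) ℂ} (hr : ∀ j, r j ∈ homogPart M 1)
    {i : Fin n → ℕ} (hi : normI i ≤ N) {p : MvPolynomial (Fin (M + 1)) ℂ} :
    p ∈ IfilSet M n I r i N ↔ p ∈ homogPart M (N - normI i) ∧
      rPowMulMod I r i p ∈ ⨆ e ∈ ((tauN n N).map toLex.toEmbedding).filter (toLex i < ·),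
        (homogPart M (N - normI (ofLex e))).map (rPowMulMod I r (ofLex e)) := by
  refine and_congr_right fun hp => ⟨?_, fun h => ?_⟩
  · rintro ⟨s, c, hs, hI, -⟩
    have heq : rPowMulMod I r i p = ∑ e ∈ s, rPowMulMod I r e (c e) := by
      exact ((Submodule.Quotient.eq (I.restrictScalars ℂ)).2 hI).trans
        (map_sum (I.restrictScalars ℂ).mkQ _ _)
    rw [heq]
    refine Submodule.sum_mem _ fun e he => ?_
    obtain ⟨hlt, hle, hc⟩ := hs e he
    refine Submodule.mem_iSup_of_mem (toLex e) (Submodule.mem_iSup_of_mem ?_ ?_)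
    · simpa [mem_tauN] using ⟨hle, hlt⟩
    · exact Submodule.mem_map_of_mem hc
  · obtain ⟨μ, hμ⟩ := (Submodule.mem_iSup_finset_iff_exists_sum _ _).1 h
    choose c hc hcμ using fun e => Submodule.mem_map.1 (μ e).2
    have hs : ∀ e ∈ (tauN n N).filter (fun e => toLex i < toLex e),
        toLex i < toLex e ∧ normI e ≤ N ∧ c (toLex e) ∈ homogPart M (N - normI e) := fun e he => by
      rw [Finset.mem_filter, mem_tauN] at he
      exact ⟨he.2, he.1, hc (toLex e)⟩
    refine ⟨(tauN n N).filter (fun e => toLex i < toLex e), fun e => c (toLex e), hs, ?_, ?_⟩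
    · refine (Submodule.Quotient.eq (I.restrictScalars ℂ)).1 ?_
      change rPowMulMod I r i p = (I.restrictScalars ℂ).mkQ _
      rw [← hμ, map_sum, Finset.filter_map, Finset.sum_map]
      exact Finset.sum_congr rfl fun e _ => (hcμ (toLex e)).symm
    · refine Submodule.sub_mem _ (rPow_mul_mem_homogPart hr hi hp)
        (Submodule.sum_mem _ fun e he => ?_)
      exact rPow_mul_mem_homogPart hr (hs e he).2.1 (hs e he).2.2

theorem comap_subtype_span_IfilSet {M n N : ℕ} {I : Ideal (MvPolynomial (Fin (M + 1)) ℂ)}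
    {r : Fin n → MvPolynomial (Fin (M + 1)) ℂ} (hr : ∀ j, r j ∈ homogPart M 1)
    {i : Fin n → ℕ} (hi : normI i ≤ N) :
    (Submodule.span ℂ (IfilSet M n I r i N)).comap (homogPart M (N - normI i)).subtype =
      ((⨆ e ∈ ((tauN n N).map toLex.toEmbedding).filter (toLex i < ·),
        (homogPart M (N - normI (ofLex e))).map (rPowMulMod I r (ofLex e))).comap
          (rPowMulMod I r i)).comap (homogPart M (N - normI i)).subtype := by
  ext p
  refine ⟨fun h => ?_, fun h => Submodule.subset_span ((mem_IfilSet_iff hr hi).2 ⟨p.2, h⟩)⟩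
  rw [Submodule.mem_comap] at h ⊢
  exact Submodule.span_le.2 (fun q hq => Submodule.mem_comap.2 ((mem_IfilSet_iff hr hi).1 hq).2) h

theorem iSup_map_rPowMulMod {M n N : ℕ} (I : Ideal (MvPolynomial (Fin (M + 1)) ℂ))
    {r : Fin n → MvPolynomial (Fin (M + 1)) ℂ} (hr : ∀ j, r j ∈ homogPart M 1) :
    ⨆ e ∈ (tauN n N).map toLex.toEmbedding,
        (homogPart M (N - normI (ofLex e))).map (rPowMulMod I r (ofLex e)) =
      (homogPart M N).map (I.restrictScalars ℂ).mkQ := by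
  refine le_antisymm (iSup₂_le fun e he => ?_) ?_
  · have hle : normI (ofLex e) ≤ N := by
      obtain ⟨e', he', rfl⟩ := Finset.mem_map.1 he
      exact mem_tauN.1 he'
    rintro _ ⟨p, hp, rfl⟩
    exact Submodule.mem_map_of_mem (rPow_mul_mem_homogPart hr hle hp)
  · have hzero : normI (0 : Fin n → ℕ) = 0 := by simp [normI]
    rintro _ ⟨p, hp, rfl⟩
    refine Submodule.mem_iSup_of_mem (toLex 0) (Submodule.mem_iSup_of_mem ?_ ⟨p, ?_, ?_⟩)
    · exact Finset.mem_map_of_mem _ (mem_tauN.2 (hzero.trans_le N.zero_le))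
    · simpa [hzero] using hp
    · have hone : rPow r 0 = 1 := Finset.prod_eq_one fun j _ => pow_zero _
      simp [rPowMulMod, hone]

/-- For every `N ≥ 0`, `Σ_{𝐢 ∈ τ_N} Δ^𝐢_N = dim_ℂ (ℂ[x]_N / I_N)`. -/
theorem sum_Delta_eq_hilbert (M n : ℕ) (hM : 1 ≤ M) (hn : 1 ≤ n)
    (I : Ideal (MvPolynomial (Fin (M + 1)) ℂ)) (hI : IsHomogeneousIdeal I)
    (r : Fin n → MvPolynomial (Fin (M + 1)) ℂ)
    (hr : ∀ j, r j ≠ 0 ∧ r j ∈ homogPart M 1) (N : ℕ) :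
    ∑ i ∈ tauN n N, Delta M n I r i N = DeltaV M I N := by
  have hlin := fun j => (hr j).2
  have hsum := sum_finrank_quotient_comap_iSup
    (fun e : Lex (Fin n → ℕ) => homogPart M (N - normI (ofLex e)))
    (fun e => rPowMulMod I r (ofLex e)) ((tauN n N).map toLex.toEmbedding)
  rw [iSup_map_rPowMulMod I hlin, Finset.sum_map] at hsum
  have hV := finrank_quotient_comap_add_finrank (homogPart M N) (I.restrictScalars ℂ).mkQ ⊥
  rw [sup_bot_eq, finrank_bot, add_zero, ← LinearMap.ker, Submodule.ker_mkQ] at hV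
  rw [DeltaV, hV, ← hsum]
  refine Finset.sum_congr rfl fun i hi => ?_
  rw [Delta, comap_subtype_span_IfilSet hlin (mem_tauN.1 hi)]
  rfl
end

section
/- Let κ ≥ 1 and b ≥ 1 be integers, and let t_1,…,t_κ be non-negative real numbers with t_1 + ⋯ + t_κ = 1. Then there exists a tuple (a_1,…,a_κ) of non-negative integers with a_1 + ⋯ + a_κ = b such that a_i ≤ (b+κ)·t_i for every i = 1,…,κ. -/
theorem exists_le_sum_eq {ι : Type*} [Fintype ι] (c : ι → ℕ) (n : ℕ) (hn : n ≤ ∑ i, c i) :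
    ∃ a ≤ c, ∑ i, a i = n := by
  classical
  induction n with
  | zero => exact ⟨0, fun i => Nat.zero_le _, by simp⟩
  | succ n ih =>
    obtain ⟨a, hac, ha⟩ := ih (by omega)
    obtain ⟨j, -, hj⟩ := Finset.exists_lt_of_sum_lt (show ∑ i, a i < ∑ i, c i by omega)
    refine ⟨a + Pi.single j 1, fun i => ?_, by simp [Finset.sum_add_distrib, ha]⟩
    obtain rfl | hij := eq_or_ne i j
    · simpa using hj
    · simpa [hij] using hac i

/-- For non-negative reals `t_1,…,t_κ` summing to `1` and any positive integer `b`, there is a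
tuple of non-negative integers `a_1,…,a_κ` with `Σ a_i = b` and `a_i ≤ (b+κ)·t_i` for all `i`. -/
theorem exists_integer_tuple (κ b : ℕ) (hκ : 1 ≤ κ) (hb : 1 ≤ b)
    (t : Fin κ → ℝ) (ht : ∀ i, 0 ≤ t i) (hsum : ∑ i, t i = 1) :
    ∃ a : Fin κ → ℕ, (∑ i, a i = b) ∧ ∀ i, (a i : ℝ) ≤ ((b : ℝ) + (κ : ℝ)) * t i := by
  have hfloor : b ≤ ∑ i, ⌊((b : ℝ) + κ) * t i⌋₊ := by
    have h : ∑ i, ((b : ℝ) + κ) * t i ≤ ∑ i, ((⌊((b : ℝ) + κ) * t i⌋₊ : ℝ) + 1) :=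
      Finset.sum_le_sum fun i _ => (Nat.lt_floor_add_one _).le
    rw [← Finset.mul_sum, hsum, Finset.sum_add_distrib] at h
    simp only [mul_one, Finset.sum_const, Finset.card_univ, Fintype.card_fin, nsmul_eq_mul,
      add_le_add_iff_right] at h
    exact_mod_cast h
  obtain ⟨a, hac, ha⟩ := exists_le_sum_eq _ b hfloor
  refine ⟨a, ha, fun i => ?_⟩
  have hnonneg : 0 ≤ ((b : ℝ) + κ) * t i := mul_nonneg (by positivity) (ht i)
  exact (Nat.cast_le.mpr (hac i)).trans (Nat.floor_le hnonneg)
end
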